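/- arXiv:1007.0136 — 4 statements merged into one kernel-verified Lean document; each statement's English description precedes it below -/
import Mathlib

section
/- Let α and β be real entire functions with no common zeros. Then there exist real entire functions γ and δ such that γ(z)β(z) − α(z)δ(z) = 1 for all z ∈ ℂ. (This is the complex-analytic content of the paper's Lemma 2.4: existence of a second entire solution θ(z,x) = γ(z)c(z,x) + δ(z)s(z,x) with Wronskian W(θ(z),φ(z)) = γ(z)β(z) − α(z)δ(z) = 1.) -/
open Filter Topology Metric Set
open scoped ComplexConjugate

/-- An entire function that is not identically zero is a power of `z - a` times an entire function
not vanishing at `a`. -/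
theorem Differentiable.exists_eq_pow_mul_ne_zero {f : ℂ → ℂ} (hf : Differentiable ℂ f)
    (h0 : ∃ z, f z ≠ 0) (a : ℂ) :
    ∃ (n : ℕ) (g : ℂ → ℂ), Differentiable ℂ g ∧ g a ≠ 0 ∧ ∀ z, f z = (z - a) ^ n * g z := by
  have hne : ¬∀ᶠ z in 𝓝 a, f z = 0 := by
    intro h
    obtain ⟨z, hz⟩ := h0
    have hfa : AnalyticOnNhd ℂ f univ := fun z _ => hf.analyticAt z
    exact hz (hfa.eqOn_zero_of_preconnected_of_eventuallyEq_zero isPreconnected_univ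
      (mem_univ a) h (mem_univ z))
  obtain ⟨n, g, hg, hga, hfg⟩ :=
    (hf.analyticAt a).exists_eventuallyEq_pow_smul_nonzero_iff.mpr hne
  let G : ℂ → ℂ := fun z => if z = a then g a else f z / (z - a) ^ n
  have hGg : G =ᶠ[𝓝 a] g := by
    filter_upwards [hfg] with z hz
    by_cases hza : z = a
    · simp [G, hza]
    · have : (z - a) ^ n ≠ 0 := pow_ne_zero _ (sub_ne_zero.mpr hza)
      simp only [G, if_neg hza, hz, smul_eq_mul]
      field_simp
  refine ⟨n, G, fun z => ?_, by simpa [G] using hga, fun z => ?_⟩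
  · by_cases hza : z = a
    · subst hza
      exact hg.differentiableAt.congr_of_eventuallyEq hGg
    · have hG : G =ᶠ[𝓝 z] fun w => f w / (w - a) ^ n := by
        filter_upwards [isOpen_ne.mem_nhds hza] with w hw
        simp only [G]
        exact if_neg hw
      refine DifferentiableAt.congr_of_eventuallyEq ?_ hG
      exact (hf z).div (by fun_prop) (pow_ne_zero _ (sub_ne_zero.mpr hza))
  · by_cases hza : z = a
    · subst hza
      simpa [G] using hfg.self_of_nhds
    · have : (z - a) ^ n ≠ 0 := pow_ne_zero _ (sub_ne_zero.mpr hza)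
      simp only [G, if_neg hza]
      field_simp

/-- The zeros of an entire function in a finite set can be split off as a polynomial factor. -/
theorem Differentiable.exists_polynomial_mul_ne_zero_of_finset {f : ℂ → ℂ}
    (hf : Differentiable ℂ f) (h0 : ∃ z, f z ≠ 0) (S : Finset ℂ) :
    ∃ (P : Polynomial ℂ) (g : ℂ → ℂ), Differentiable ℂ g ∧ (∀ z ∈ S, g z ≠ 0) ∧
      ∀ z, f z = P.eval z * g z := by
  induction S using Finset.induction_on with
  | empty => exact ⟨1, f, hf, by simp, by simp⟩
  | insert a S _ ih =>
    obtain ⟨P, g, hg, hgS, hfg⟩ := ih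
    have hg0 : ∃ z, g z ≠ 0 := h0.imp fun z hz => right_ne_zero_of_mul (hfg z ▸ hz)
    obtain ⟨n, g', hg', hga, hgg⟩ := hg.exists_eq_pow_mul_ne_zero hg0 a
    refine ⟨P * (Polynomial.X - Polynomial.C a) ^ n, g', hg', fun z hz => ?_, fun z => ?_⟩
    · rcases Finset.mem_insert.mp hz with rfl | hz
      · exact hga
      · exact right_ne_zero_of_mul (hgg z ▸ hgS z hz)
    · simp [hfg, hgg, mul_assoc]

/-- The zeros of an entire function in a compact set can be split off as a polynomial factor. -/
theorem Differentiable.exists_polynomial_mul_ne_zero_of_isCompact {f : ℂ → ℂ}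
    (hf : Differentiable ℂ f) (h0 : ∃ z, f z ≠ 0) {K : Set ℂ} (hK : IsCompact K) :
    ∃ (P : Polynomial ℂ) (g : ℂ → ℂ), Differentiable ℂ g ∧ (∀ z ∈ K, g z ≠ 0) ∧
      ∀ z, f z = P.eval z * g z := by
  have hfin : (K ∩ f ⁻¹' {0}).Finite := by
    by_contra hinf
    obtain ⟨x, -, hx⟩ := Set.Infinite.exists_accPt_of_subset_isCompact hinf hK inter_subset_left
    obtain ⟨z, hz⟩ := h0
    have hfa : AnalyticOnNhd ℂ f univ := fun z _ => hf.analyticAt z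
    refine hz (hfa.eqOn_zero_of_preconnected_of_frequently_eq_zero isPreconnected_univ
      (mem_univ x) ?_ (mem_univ z))
    exact (accPt_iff_frequently_nhdsNE.mp hx).mono fun y hy => hy.2
  obtain ⟨P, g, hg, hgS, hfg⟩ := hf.exists_polynomial_mul_ne_zero_of_finset h0 hfin.toFinset
  refine ⟨P, g, hg, fun z hz hgz => ?_, hfg⟩
  exact hgS z (hfin.mem_toFinset.mpr ⟨hz, by simp [hfg, hgz]⟩) hgz

/-- Entire functions without common zeros generate the unit ideal on every disc. -/
theorem exists_bezout_on_ball {α β : ℂ → ℂ} (hα : Differentiable ℂ α) (hβ : Differentiable ℂ β)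
    (hcz : ∀ z, α z ≠ 0 ∨ β z ≠ 0) (hα0 : ∃ z, α z ≠ 0) (hβ0 : ∃ z, β z ≠ 0) (r : ℝ) :
    ∃ γ δ : ℂ → ℂ, DifferentiableOn ℂ γ (ball 0 r) ∧ DifferentiableOn ℂ δ (ball 0 r) ∧
      ∀ z ∈ ball (0 : ℂ) r, γ z * β z - α z * δ z = 1 := by
  obtain ⟨P, u, hu, hu0, hαP⟩ :=
    hα.exists_polynomial_mul_ne_zero_of_isCompact hα0 (isCompact_closedBall 0 r)
  obtain ⟨Q, v, hv, hv0, hβQ⟩ :=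
    hβ.exists_polynomial_mul_ne_zero_of_isCompact hβ0 (isCompact_closedBall 0 r)
  have hPQ : IsCoprime P Q := by
    refine (Polynomial.isCoprime_iff_aeval_ne_zero_of_isAlgClosed (k := ℂ) ℂ P Q).mpr fun z => ?_
    simp only [Polynomial.coe_aeval_eq_eval]
    exact (hcz z).imp (fun h => left_ne_zero_of_mul (hαP z ▸ h))
      (fun h => left_ne_zero_of_mul (hβQ z ▸ h))
  obtain ⟨A, B, hAB⟩ := hPQ
  refine ⟨fun z => B.eval z / v z, fun z => -(A.eval z / u z), ?_, ?_, fun z hz => ?_⟩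
  · exact B.differentiable.differentiableOn.div hv.differentiableOn
      fun z hz => hv0 z (ball_subset_closedBall hz)
  · exact (A.differentiable.differentiableOn.div hu.differentiableOn
      fun z hz => hu0 z (ball_subset_closedBall hz)).neg
  · have h1 := hu0 z (ball_subset_closedBall hz)
    have h2 := hv0 z (ball_subset_closedBall hz)
    have h3 : A.eval z * P.eval z + B.eval z * Q.eval z = 1 := by
      simpa using congrArg (Polynomial.eval z) hAB
    rw [hαP, hβQ]
    field_simp
    linear_combination h3

/-- Holomorphic functions on a disc are uniform limits of entire functions on smaller discs. -/
theorem DifferentiableOn.exists_entire_norm_sub_lt {h : ℂ → ℂ} {r R : ℝ} (hr : 0 ≤ r)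
    (hrR : r < R) (hh : DifferentiableOn ℂ h (ball 0 R)) {ε : ℝ} (hε : 0 < ε) :
    ∃ p : ℂ → ℂ, Differentiable ℂ p ∧ ∀ z ∈ ball (0 : ℂ) r, ‖h z - p z‖ < ε := by
  obtain ⟨s, hrs, hsR⟩ := exists_between hrR
  lift r to NNReal using hr
  lift s to NNReal using r.2.trans hrs.le
  have hs : 0 < s := (show r < s by exact_mod_cast hrs).pos
  have hps := (hh.mono (closedBall_subset_ball hsR)).hasFPowerSeriesOnBall hs
  have hlim := hps.tendstoUniformlyOn' (r' := r) (by exact_mod_cast hrs)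
  obtain ⟨n, hn⟩ := (Metric.tendstoUniformlyOn_iff.mp hlim ε hε).exists
  refine ⟨fun z => (cauchyPowerSeries h 0 s).partialSum n z, ?_,
    fun z hz => by simpa [dist_eq_norm] using hn z hz⟩
  simp only [FormalMultilinearSeries.partialSum, FormalMultilinearSeries.apply_eq_pow_smul_coeff]
  fun_prop

/-- The additive Cousin problem for an exhaustion of the plane by discs is solvable. -/
theorem exists_sub_succ_eq_on_ball {h : ℕ → ℂ → ℂ}
    (hh : ∀ n : ℕ, DifferentiableOn ℂ (h n) (ball 0 (n + 1))) :
    ∃ e : ℕ → ℂ → ℂ, (∀ n : ℕ, DifferentiableOn ℂ (e n) (ball 0 n)) ∧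
      ∀ n : ℕ, ∀ z ∈ ball (0 : ℂ) n, h n z = e n z - e (n + 1) z := by
  choose p hp hpb using fun n : ℕ => (hh n).exists_entire_norm_sub_lt (Nat.cast_nonneg n)
    (lt_add_one (n : ℝ)) (show (0 : ℝ) < (1 / 2) ^ n by positivity)
  have hsum (n : ℕ) : Summable fun j : ℕ => (1 / 2 : ℝ) ^ (n + j) := by
    simpa [pow_add] using summable_geometric_two.mul_left ((1 / 2 : ℝ) ^ n)
  have hbound (n j : ℕ) (z : ℂ) (hz : z ∈ ball (0 : ℂ) n) :
      ‖h (n + j) z - p (n + j) z‖ ≤ (1 / 2 : ℝ) ^ (n + j) :=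
    (hpb (n + j) z (ball_subset_ball (by simp) hz)).le
  refine ⟨fun n z => ∑' j, (h (n + j) z - p (n + j) z) - ∑ k ∈ Finset.range n, p k z,
    fun n => ?_, fun n z hz => ?_⟩
  · refine DifferentiableOn.sub ?_ (DifferentiableOn.fun_sum fun k _ => (hp k).differentiableOn)
    refine Complex.differentiableOn_tsum_of_summable_norm (hsum n) (fun j => ?_) isOpen_ball
      (hbound n)
    refine ((hh (n + j)).mono (ball_subset_ball ?_)).sub (hp _).differentiableOn
    push_cast
    linarith [(Nat.cast_nonneg j : (0 : ℝ) ≤ j)]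
  · have hs : Summable fun j => h (n + j) z - p (n + j) z :=
      Summable.of_norm_bounded (hsum n) fun j => hbound n j z hz
    beta_reduce
    rw [hs.tsum_eq_zero_add, Finset.sum_range_succ]
    simp only [← add_assoc, add_right_comm n 1, add_zero]
    ring

/-- Holomorphic functions on concentric discs that agree on overlaps glue to an entire function. -/
theorem exists_entire_eqOn_ball {F : ℕ → ℂ → ℂ}
    (hF : ∀ n : ℕ, DifferentiableOn ℂ (F n) (ball 0 n))
    (hcompat : ∀ n : ℕ, ∀ z ∈ ball (0 : ℂ) n, F n z = F (n + 1) z) :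
    ∃ G : ℂ → ℂ, Differentiable ℂ G ∧ ∀ n : ℕ, ∀ z ∈ ball (0 : ℂ) n, G z = F n z := by
  have hle {m n : ℕ} (hmn : m ≤ n) (z : ℂ) (hz : z ∈ ball (0 : ℂ) m) : F m z = F n z := by
    induction n, hmn using Nat.le_induction with
    | base => rfl
    | succ n hmn ih =>
      exact ih.trans (hcompat n z (ball_subset_ball (by exact_mod_cast hmn) hz))
  have hmem (z : ℂ) : z ∈ ball (0 : ℂ) ((⌊‖z‖⌋₊ + 1 : ℕ) : ℝ) := by
    simpa using Nat.lt_floor_add_one ‖z‖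
  have hG (n : ℕ) (z : ℂ) (hz : z ∈ ball (0 : ℂ) n) : F (⌊‖z‖⌋₊ + 1) z = F n z := by
    rcases le_total (⌊‖z‖⌋₊ + 1) n with hn | hn
    · exact hle hn z (hmem z)
    · exact (hle hn z hz).symm
  refine ⟨fun z => F (⌊‖z‖⌋₊ + 1) z, fun z => ?_, hG⟩
  have hnhds := isOpen_ball.mem_nhds (hmem z)
  refine ((hF _).differentiableAt hnhds).congr_of_eventuallyEq ?_
  filter_upwards [hnhds] with w hw using hG _ w hw

/-- Entire functions without common zeros generate the unit ideal. -/
theorem exists_entire_bezout {α β : ℂ → ℂ} (hα : Differentiable ℂ α) (hβ : Differentiable ℂ β)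
    (hcz : ∀ z, α z ≠ 0 ∨ β z ≠ 0) :
    ∃ γ δ : ℂ → ℂ, Differentiable ℂ γ ∧ Differentiable ℂ δ ∧
      ∀ z, γ z * β z - α z * δ z = 1 := by
  by_cases hα0 : ∃ z, α z ≠ 0
  swap
  · push Not at hα0
    have hβ0 (z : ℂ) : β z ≠ 0 := (hcz z).resolve_left (by simp [hα0])
    exact ⟨fun z => (β z)⁻¹, 0, hβ.inv hβ0, differentiable_const 0, fun z => by simp [hβ0]⟩
  by_cases hβ0 : ∃ z, β z ≠ 0
  swap
  · push Not at hβ0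
    have hα0 (z : ℂ) : α z ≠ 0 := (hcz z).resolve_right (by simp [hβ0])
    exact ⟨0, fun z => -(α z)⁻¹, differentiable_const 0, (hα.inv hα0).neg,
      fun z => by simp [hα0]⟩
  choose γ δ hγ hδ hγδ using fun n : ℕ => exists_bezout_on_ball hα hβ hcz hα0 hβ0 ((n : ℝ) + 1)
  have hsub (n : ℕ) : ball (0 : ℂ) ((n : ℝ) + 1) ⊆ ball 0 (((n + 1 : ℕ) : ℝ) + 1) :=
    ball_subset_ball (by push_cast; linarith)
  have hsub' (n : ℕ) : ball (0 : ℂ) (n : ℝ) ⊆ ball 0 ((n : ℝ) + 1) :=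
    ball_subset_ball (by linarith)
  obtain ⟨e, he, hee⟩ := exists_sub_succ_eq_on_ball
    (h := fun n z => γ n z * δ (n + 1) z - γ (n + 1) z * δ n z) fun n =>
      ((hγ n).mul ((hδ (n + 1)).mono (hsub n))).sub (((hγ (n + 1)).mono (hsub n)).mul (hδ n))
  obtain ⟨G, hG, hGe⟩ := exists_entire_eqOn_ball (F := fun n z => γ n z + e n z * α z)
    (fun n => ((hγ n).mono (hsub' n)).add ((he n).mul hα.differentiableOn)) fun n z hz => by
      linear_combination (-α z) * hee n z hz + γ (n + 1) z * hγδ n z (hsub' n hz) -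
        γ n z * hγδ (n + 1) z (hsub n (hsub' n hz))
  obtain ⟨D, hD, hDe⟩ := exists_entire_eqOn_ball (F := fun n z => δ n z + e n z * β z)
    (fun n => ((hδ n).mono (hsub' n)).add ((he n).mul hβ.differentiableOn)) fun n z hz => by
      linear_combination (-β z) * hee n z hz + δ (n + 1) z * hγδ n z (hsub' n hz) -
        δ n z * hγδ (n + 1) z (hsub n (hsub' n hz))
  refine ⟨G, D, hG, hD, fun z => ?_⟩
  obtain ⟨n, hn⟩ := exists_nat_gt ‖z‖
  have hz : z ∈ ball (0 : ℂ) n := by simpa using hn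
  rw [hGe n z hz, hDe n z hz]
  linear_combination hγδ n z (hsub' n hz)

/-- The Schwarz reflection of an entire function is entire. -/
theorem Differentiable.conj_comp_conj {f : ℂ → ℂ} (hf : Differentiable ℂ f) :
    Differentiable ℂ fun z => conj (f (conj z)) := fun z => by
  have h := (hf (conj z)).conj_conj
  rwa [Complex.conj_conj] at h

/-- An entire function that is real on the real axis commutes with complex conjugation. -/
theorem Differentiable.apply_conj_of_im_eq_zero {f : ℂ → ℂ} (hf : Differentiable ℂ f)
    (hr : ∀ x : ℝ, (f x).im = 0) (z : ℂ) : f (conj z) = conj (f z) := by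
  have hfa : AnalyticOnNhd ℂ f univ := fun z _ => hf.analyticAt z
  have hga : AnalyticOnNhd ℂ (fun z => conj (f (conj z))) univ :=
    fun z _ => hf.conj_comp_conj.analyticAt z
  have htend : Tendsto ((↑) : ℝ → ℂ) (𝓝[≠] 0) (𝓝[≠] 0) := by
    refine tendsto_nhdsWithin_of_tendsto_nhds_of_eventually_within _ ?_ ?_
    · exact (Complex.continuous_ofReal.tendsto' 0 0 rfl).mono_left nhdsWithin_le_nhds
    · filter_upwards [self_mem_nhdsWithin] with x hx
      simpa using hx
  have heq : f = fun z => conj (f (conj z)) := by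
    refine hfa.eq_of_frequently_eq (z₀ := 0) hga (htend.frequently ?_)
    refine Eventually.frequently (Eventually.of_forall fun x => ?_)
    simpa using (Complex.conj_eq_iff_im.mpr (hr x)).symm
  simpa using congrFun heq (conj z)

/-- If `α` and `β` are real entire functions (entire, real-valued on ℝ)
with no common zeros, then there exist real entire functions `γ`, `δ` with
`γ z * β z - α z * δ z = 1` for all `z ∈ ℂ`. -/
theorem stmt_0 (α β : ℂ → ℂ)
    (hαe : Differentiable ℂ α) (hβe : Differentiable ℂ β)
    (hαr : ∀ x : ℝ, (α x).im = 0) (hβr : ∀ x : ℝ, (β x).im = 0)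
    (hcz : ∀ z : ℂ, α z ≠ 0 ∨ β z ≠ 0) :
    ∃ γ δ : ℂ → ℂ,
      Differentiable ℂ γ ∧ Differentiable ℂ δ ∧
      (∀ x : ℝ, (γ x).im = 0) ∧ (∀ x : ℝ, (δ x).im = 0) ∧
      ∀ z : ℂ, γ z * β z - α z * δ z = 1 := by
  obtain ⟨γ, δ, hγ, hδ, h⟩ := exists_entire_bezout hαe hβe hcz
  refine ⟨fun z => (γ z + conj (γ (conj z))) / 2, fun z => (δ z + conj (δ (conj z))) / 2,
    (hγ.add hγ.conj_comp_conj).div_const 2, (hδ.add hδ.conj_comp_conj).div_const 2,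
    fun x => by simp [Complex.add_conj], fun x => by simp [Complex.add_conj], fun z => ?_⟩
  have hc := congrArg conj (h (conj z))
  simp only [map_sub, map_mul, map_one, hαe.apply_conj_of_im_eq_zero hαr,
    hβe.apply_conj_of_im_eq_zero hβr, Complex.conj_conj] at hc
  linear_combination (h z + hc) / 2
end

section
/- Let (α, β) and (α̃, β̃) be two pairs of real entire functions such that α and β have no common zeros, α̃ and β̃ have no common zeros, and α(z)β̃(z) = α̃(z)β(z) for all z ∈ ℂ. Then there exist a real entire function g and a sign σ ∈ {+1, −1} such that α̃(z) = σ e^{g(z)} α(z) and β̃(z) = σ e^{g(z)} β(z) for all z ∈ ℂ. (This is the paper's Corollary 2.3: the solution φ(z,x) = α(z)c(z,x) + β(z)s(z,x) is unique up to a nonvanishing real entire factor.) -/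
/-- The imaginary part of an entire function along the real axis has derivative `(f' x).im`. -/
lemma hasDerivAt_im_ofReal {f : ℂ → ℂ} {f' : ℂ} {x : ℝ} (hf : HasDerivAt f f' (x : ℂ)) :
    HasDerivAt (fun t : ℝ => (f t).im) f'.im x :=
  Complex.imCLM.hasFDerivAt.comp_hasDerivAt x hf.comp_ofReal

/-- A nonvanishing real entire function is `± exp g` with `g` real entire. -/
lemma exists_sign_mul_exp_of_real_entire {h : ℂ → ℂ} (hd : Differentiable ℂ h)
    (hr : ∀ x : ℝ, (h x).im = 0) (h0 : ∀ z, h z ≠ 0) :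
    ∃ g : ℂ → ℂ, ∃ σ : ℂ, (σ = 1 ∨ σ = -1) ∧ Differentiable ℂ g ∧
      (∀ x : ℝ, (g x).im = 0) ∧ ∀ z, h z = σ * Complex.exp (g z) := by
  have hlog : Differentiable ℂ (fun z => deriv h z / h z) := fun z =>
    (hd.contDiff.differentiable_deriv_two z).div (hd z) (h0 z)
  obtain ⟨G, hG⟩ := hlog.isExactOn_univ
  replace hG : ∀ z, HasDerivAt G (deriv h z / h z) z := fun z => hG z (Set.mem_univ z)
  have hGd : Differentiable ℂ G := fun z => (hG z).differentiableAt
  have hlogr : ∀ x : ℝ, (deriv h x / h x).im = 0 := by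
    intro x
    have h1 := hasDerivAt_im_ofReal (hd x).hasDerivAt
    have h2 : (fun t : ℝ => (h t).im) = fun _ => 0 := funext hr
    rw [h2] at h1
    have h3 := h1.unique (hasDerivAt_const x (0 : ℝ))
    simp [Complex.div_im, h3, hr x]
  have hGr : ∀ x : ℝ, (G x - G 0).im = 0 := by
    intro x
    have hder : ∀ t : ℝ, HasDerivAt (fun t : ℝ => (G t).im) 0 t := fun t => by
      simpa only [hlogr t] using hasDerivAt_im_ofReal (hG t)
    have := is_const_of_deriv_eq_zero (fun t => (hder t).differentiableAt)
      (fun t => (hder t).deriv) x 0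
    simpa [sub_eq_zero] using this
  have hconst : ∀ z, h z = h 0 * Complex.exp (G z - G 0) := by
    have hder : ∀ z, HasDerivAt (fun z => h z * Complex.exp (-(G z - G 0))) 0 z := fun z => by
      refine ((hd z).hasDerivAt.mul ((hG z).sub_const (G 0)).neg.cexp).congr_deriv ?_
      have := h0 z
      simp only [Pi.neg_apply]
      field_simp
      ring
    intro z
    have := is_const_of_deriv_eq_zero (fun t => (hder t).differentiableAt)
      (fun t => (hder t).deriv) z 0
    simp only [sub_self, neg_zero, Complex.exp_zero, mul_one] at this
    rw [← this, mul_assoc, ← Complex.exp_add]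
    simp
  have hre : h 0 = ((h 0).re : ℂ) := Complex.ext (by simp) (by simpa using hr 0)
  have hre0 : (h 0).re ≠ 0 := fun e => h0 0 (by rw [hre, e, Complex.ofReal_zero])
  have hsign : ∃ σ : ℂ, (σ = 1 ∨ σ = -1) ∧
      h 0 = σ * Complex.exp (Real.log (h 0).re : ℂ) := by
    rw [← Complex.ofReal_exp, Real.exp_log_eq_abs hre0]
    rcases abs_cases (h 0).re with ⟨e, -⟩ | ⟨e, -⟩
    · exact ⟨1, Or.inl rfl, by rw [e, one_mul]; exact hre⟩
    · exact ⟨-1, Or.inr rfl, by rw [e, Complex.ofReal_neg, neg_one_mul, neg_neg]; exact hre⟩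
  obtain ⟨σ, hσ, hσh⟩ := hsign
  refine ⟨fun z => (Real.log (h 0).re : ℂ) + (G z - G 0), σ, hσ,
    (hGd.sub_const _).const_add _, fun x => ?_, fun z => ?_⟩
  · rw [Complex.add_im, hGr x, Complex.ofReal_im, add_zero]
  · rw [Complex.exp_add, ← mul_assoc, ← hσh]
    exact hconst z

/-- Two proportional pairs of entire functions, each without common zeros, differ by a
nonvanishing entire factor, which takes at every point one of the two quotients as its value. -/
lemma exists_entire_factor {α β α' β' : ℂ → ℂ}
    (hα : Differentiable ℂ α) (hβ : Differentiable ℂ β)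
    (hα' : Differentiable ℂ α') (hβ' : Differentiable ℂ β')
    (hcz : ∀ z, α z ≠ 0 ∨ β z ≠ 0) (hcz' : ∀ z, α' z ≠ 0 ∨ β' z ≠ 0)
    (hprop : ∀ z, α z * β' z = α' z * β z) :
    ∃ h : ℂ → ℂ, Differentiable ℂ h ∧ (∀ z, h z ≠ 0) ∧
      (∀ z, α' z = h z * α z) ∧ (∀ z, β' z = h z * β z) ∧
      ∀ z, h z = α' z / α z ∨ h z = β' z / β z := by
  classical
  let h : ℂ → ℂ := fun z => if α z = 0 then β' z / β z else α' z / α z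
  have hhα : ∀ z, α z ≠ 0 → h z = α' z / α z := fun z hz => if_neg hz
  have hhβ : ∀ z, β z ≠ 0 → h z = β' z / β z := by
    intro z hz
    by_cases ha : α z = 0
    · exact if_pos ha
    · rw [hhα z ha, div_eq_div_iff ha hz, ← hprop z, mul_comm]
  have hmulα : ∀ z, α' z = h z * α z := by
    intro z
    by_cases ha : α z = 0
    · have hp := hprop z
      rw [ha, zero_mul, eq_comm] at hp
      rw [ha, mul_zero]
      exact (mul_eq_zero.1 hp).resolve_right ((hcz z).resolve_left (not_not.2 ha))
    · rw [hhα z ha, div_mul_cancel₀ _ ha]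
  have hmulβ : ∀ z, β' z = h z * β z := by
    intro z
    by_cases hb : β z = 0
    · have hp := hprop z
      rw [hb, mul_zero] at hp
      rw [hb, mul_zero]
      exact (mul_eq_zero.1 hp).resolve_left ((hcz z).resolve_right (not_not.2 hb))
    · rw [hhβ z hb, div_mul_cancel₀ _ hb]
  refine ⟨h, fun z => ?_, fun z hz => ?_, hmulα, hmulβ, fun z => ?_⟩
  · rcases hcz z with ha | hb
    · exact ((hα' z).div (hα z) ha).congr_of_eventuallyEq
        ((hα.continuous.continuousAt.eventually_ne ha).mono hhα)
    · exact ((hβ' z).div (hβ z) hb).congr_of_eventuallyEq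
        ((hβ.continuous.continuousAt.eventually_ne hb).mono hhβ)
  · rcases hcz' z with ha | hb
    · exact ha (by rw [hmulα, hz, zero_mul])
    · exact hb (by rw [hmulβ, hz, zero_mul])
  · exact (hcz z).imp (hhα z) (hhβ z)


/-- If `(α, β)` and `(α', β')` are pairs of real entire functions, each pair
with no common zeros, and `α z * β' z = α' z * β z` for all `z`, then there is a real
entire function `g` and a sign `σ ∈ {1, -1}` such that `α' = σ e^g α` and `β' = σ e^g β`. -/
theorem stmt_1 (α β α' β' : ℂ → ℂ)
    (hαe : Differentiable ℂ α) (hβe : Differentiable ℂ β)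
    (hα'e : Differentiable ℂ α') (hβ'e : Differentiable ℂ β')
    (hαr : ∀ x : ℝ, (α x).im = 0) (hβr : ∀ x : ℝ, (β x).im = 0)
    (hα'r : ∀ x : ℝ, (α' x).im = 0) (hβ'r : ∀ x : ℝ, (β' x).im = 0)
    (hcz : ∀ z : ℂ, α z ≠ 0 ∨ β z ≠ 0)
    (hcz' : ∀ z : ℂ, α' z ≠ 0 ∨ β' z ≠ 0)
    (hprop : ∀ z : ℂ, α z * β' z = α' z * β z) :
    ∃ g : ℂ → ℂ, ∃ σ : ℂ,
      (σ = 1 ∨ σ = -1) ∧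
      Differentiable ℂ g ∧ (∀ x : ℝ, (g x).im = 0) ∧
      (∀ z : ℂ, α' z = σ * Complex.exp (g z) * α z) ∧
      (∀ z : ℂ, β' z = σ * Complex.exp (g z) * β z) := by
  obtain ⟨h, hd, h0, hmulα, hmulβ, hquot⟩ :=
    exists_entire_factor hαe hβe hα'e hβ'e hcz hcz' hprop
  have hr : ∀ x : ℝ, (h x).im = 0 := by
    intro x
    rcases hquot x with e | e
    · simp [e, Complex.div_im, hαr x, hα'r x]
    · simp [e, Complex.div_im, hβr x, hβ'r x]
  obtain ⟨g, σ, hσ, hg, hgr, hexp⟩ := exists_sign_mul_exp_of_real_entire hd hr h0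
  exact ⟨g, σ, hσ, hg, hgr, fun z => by rw [← hexp, hmulα], fun z => by rw [← hexp, hmulβ]⟩
end

section
/- Let ρ be a positive Borel measure on ℝ which is finite on compact sets. Then there exists an entire function g : ℂ → ℂ such that g(conj z) = conj(g(z)) for all z ∈ ℂ, g(λ) ≥ 0 for all λ ∈ ℝ, and ∫_ℝ e^{−2g(λ)} dρ(λ) < ∞ (i.e., e^{−g} ∈ L²(ℝ, dρ)). (This is the first assertion of the paper's Theorem 4.1.) -/
open MeasureTheory

open Filter in
/-- Exponents `k n ≥ n` for which `(((n + 2) / (n + 1)) ^ 2) ^ k n` dominates a given sequence. -/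
theorem exists_exponents_le_pow (c : ℕ → ℝ) :
    ∃ k : ℕ → ℕ, ∀ n, n ≤ k n ∧ c n ≤ ((((n : ℝ) + 2) / (n + 1)) ^ 2) ^ k n := by
  have h : ∀ n : ℕ, ∃ k : ℕ, n ≤ k ∧ c n ≤ ((((n : ℝ) + 2) / (n + 1)) ^ 2) ^ k := by
    intro n
    have h1 : 1 < (((n : ℝ) + 2) / (n + 1)) ^ 2 := by
      refine one_lt_pow₀ ?_ two_ne_zero
      rw [one_lt_div (by positivity)]
      linarith
    exact ((eventually_ge_atTop n).and
      ((tendsto_pow_atTop_atTop_of_one_lt h1).eventually_ge_atTop (c n))).exists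
  choose k hk using h
  exact ⟨k, hk⟩

/-- If `n ≤ k n`, the series `∑ ((R / (n + 1)) ^ 2) ^ k n` converges for every `R`. -/
theorem summable_sq_div_succ_pow {k : ℕ → ℕ} (hk : ∀ n, n ≤ k n) (R : ℝ) :
    Summable fun n : ℕ => ((R / ((n : ℝ) + 1)) ^ 2) ^ k n := by
  obtain ⟨N, hN⟩ := exists_nat_ge (2 * |R|)
  refine Summable.of_norm_bounded_eventually_nat (g := fun n => (1 / 2 : ℝ) ^ n)
    (summable_geometric_of_lt_one (by norm_num) (by norm_num)) ?_
  filter_upwards [Filter.eventually_ge_atTop N] with n hn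
  have hn' : (N : ℝ) ≤ n := by exact_mod_cast hn
  have h1 : |R / ((n : ℝ) + 1)| ≤ 1 / 2 := by
    rw [abs_div, abs_of_pos (by positivity : (0 : ℝ) < n + 1), div_le_iff₀ (by positivity)]
    linarith
  have h2 : (R / ((n : ℝ) + 1)) ^ 2 ≤ 1 / 2 := by
    rw [← sq_abs]
    nlinarith [abs_nonneg (R / ((n : ℝ) + 1))]
  rw [Real.norm_of_nonneg (by positivity)]
  exact (pow_le_pow_left₀ (sq_nonneg _) h2 _).trans
    (pow_le_pow_of_le_one (by norm_num) (by norm_num) (hk n))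

/-- For every real sequence `c` there is an entire function, real and nonnegative on the real
line and symmetric under conjugation, which is at least `c n` at real points of absolute value
at least `n + 2`. -/
theorem exists_entire_nonneg_ge (c : ℕ → ℝ) :
    ∃ g : ℂ → ℂ, Differentiable ℂ g ∧
      (∀ z : ℂ, g ((starRingEnd ℂ) z) = (starRingEnd ℂ) (g z)) ∧
      (∀ l : ℝ, (g l).im = 0 ∧ 0 ≤ (g l).re) ∧
      ∀ (n : ℕ) (l : ℝ), (n : ℝ) + 2 ≤ |l| → c n ≤ (g l).re := by
  obtain ⟨k, hk⟩ := exists_exponents_le_pow c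
  have hs := summable_sq_div_succ_pow fun n => (hk n).1
  have hreal (l : ℝ) : ∑' n : ℕ, (((l : ℂ) / ((n : ℂ) + 1)) ^ 2) ^ k n =
      ((∑' n : ℕ, ((l / ((n : ℝ) + 1)) ^ 2) ^ k n : ℝ) : ℂ) := by
    rw [Complex.ofReal_tsum]
    push_cast
    rfl
  refine ⟨fun z => ∑' n : ℕ, ((z / ((n : ℂ) + 1)) ^ 2) ^ k n, ?_, ?_, ?_, ?_⟩
  · intro z
    have hd : DifferentiableOn ℂ (fun z : ℂ => ∑' n : ℕ, ((z / ((n : ℂ) + 1)) ^ 2) ^ k n)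
        (Metric.ball 0 (‖z‖ + 1)) := by
      refine Complex.differentiableOn_tsum_of_summable_norm (hs (‖z‖ + 1)) ?_
        Metric.isOpen_ball ?_
      · intro n
        fun_prop
      · intro n w hw
        have hw' : ‖w‖ ≤ ‖z‖ + 1 := (mem_ball_zero_iff.mp hw).le
        have hn : ‖(n : ℂ) + 1‖ = (n : ℝ) + 1 := by
          exact_mod_cast Complex.norm_natCast (n + 1)
        rw [norm_pow, norm_pow, norm_div, hn]
        gcongr
    exact hd.differentiableAt (Metric.isOpen_ball.mem_nhds (by simp))
  · intro z
    simp [Complex.conj_tsum]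
  · intro l
    simp only [hreal, Complex.ofReal_im, Complex.ofReal_re, true_and]
    exact tsum_nonneg fun n => by positivity
  · intro n l hl
    simp only [hreal, Complex.ofReal_re]
    refine (hk n).2.trans (le_trans ?_ ((hs l).le_tsum n fun m _ => by positivity))
    refine pow_le_pow_left₀ (by positivity) ?_ _
    rw [← sq_abs (l / _), abs_div, abs_of_pos (by positivity : (0 : ℝ) < n + 1)]
    gcongr

/-- A continuous function on `ℝ` whose products of a bound on `{n + 2 ≤ |x| ≤ n + 3}` with the
measure of this set are summable is integrable. -/
theorem integrable_of_summable_annulus_bound {ρ : Measure ℝ} [IsFiniteMeasureOnCompacts ρ]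
    {f : ℝ → ℝ} (hf : Continuous f) {b : ℕ → ℝ} (hb : ∀ n, 0 ≤ b n)
    (hfb : ∀ (n : ℕ) (x : ℝ), (n : ℝ) + 2 ≤ |x| → ‖f x‖ ≤ b n)
    (hs : Summable fun n : ℕ => b n * ρ.real {x | (n : ℝ) + 2 ≤ |x| ∧ |x| ≤ n + 3}) :
    Integrable f ρ := by
  have hK (n : ℕ) : IsCompact {x : ℝ | (n : ℝ) ≤ |x| ∧ |x| ≤ n + 1} := by
    refine (isCompact_Icc (a := -((n : ℝ) + 1)) (b := n + 1)).of_isClosed_subset ?_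
      fun x hx => abs_le.mp hx.2
    exact (isClosed_le continuous_const continuous_abs).inter
      (isClosed_le continuous_abs continuous_const)
  refine integrable_of_summable_norm_restrict (f := ⟨f, hf⟩)
    (s := fun n : ℕ => (⟨_, hK n⟩ : TopologicalSpace.Compacts ℝ)) ?_ ?_
  · rw [← summable_nat_add_iff 2]
    refine hs.of_nonneg_of_le (fun n => by positivity) fun n => ?_
    have hset : {x : ℝ | ((n + 2 : ℕ) : ℝ) ≤ |x| ∧ |x| ≤ ((n + 2 : ℕ) : ℝ) + 1} =
        {x | (n : ℝ) + 2 ≤ |x| ∧ |x| ≤ n + 3} := by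
      ext x
      push_cast
      rw [Set.mem_ofPred_eq, Set.mem_ofPred_eq, add_assoc (n : ℝ) 2 1]
      norm_num
    refine (mul_le_mul_of_nonneg_right ?_ measureReal_nonneg).trans_eq
      (congrArg (fun s => b n * ρ.real s) hset)
    rw [ContinuousMap.norm_le _ (hb n)]
    rintro ⟨x, hx⟩
    have hx' : ((n + 2 : ℕ) : ℝ) ≤ |x| := hx.1
    exact hfb n x (by exact_mod_cast hx')
  · refine Set.eq_univ_of_forall fun x => Set.mem_iUnion.mpr ⟨⌊|x|⌋₊, ?_⟩
    exact ⟨Nat.floor_le (abs_nonneg x), (Nat.lt_floor_add_one _).le⟩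

/-- Let `ρ` be a positive Borel measure on ℝ which is finite on compact sets.
Then there is an entire function `g` with `g (conj z) = conj (g z)`, `g(λ) ≥ 0` for real `λ`
(i.e. `g(λ)` is real and nonnegative), and `∫ e^{-2 g(λ)} dρ(λ) < ∞`
(so that `e^{-g} ∈ L²(ℝ, dρ)`). -/
theorem stmt_5 (ρ : Measure ℝ) [IsFiniteMeasureOnCompacts ρ] :
    ∃ g : ℂ → ℂ, Differentiable ℂ g ∧
      (∀ z : ℂ, g ((starRingEnd ℂ) z) = (starRingEnd ℂ) (g z)) ∧
      (∀ l : ℝ, (g l).im = 0 ∧ 0 ≤ (g l).re) ∧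
      Integrable (fun l : ℝ => Real.exp (-2 * (g l).re)) ρ := by
  set a : ℕ → ℝ := fun n => ρ.real {x | (n : ℝ) + 2 ≤ |x| ∧ |x| ≤ n + 3}
  have ha (n : ℕ) : 0 ≤ a n := measureReal_nonneg
  obtain ⟨g, hg, hconj, hnonneg, hge⟩ := exists_entire_nonneg_ge fun n => 2 ^ n * a n
  refine ⟨g, hg, hconj, hnonneg, ?_⟩
  have hcont : Continuous g := hg.continuous
  refine integrable_of_summable_annulus_bound (b := fun n => Real.exp (-2 * (2 ^ n * a n)))
    (by fun_prop) (fun n => (Real.exp_pos _).le) ?_ ?_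
  · intro n l hl
    rw [Real.norm_of_nonneg (Real.exp_pos _).le, Real.exp_le_exp]
    linarith [hge n l hl]
  · refine (summable_geometric_of_lt_one (r := (1 / 2 : ℝ)) (by norm_num)
      (by norm_num)).of_nonneg_of_le (fun n => by positivity) fun n => ?_
    have hc : 0 ≤ 2 ^ n * a n := mul_nonneg (by positivity) (ha n)
    rw [one_div, inv_pow, neg_mul, Real.exp_neg, inv_mul_le_iff₀ (Real.exp_pos _),
      ← div_eq_mul_inv, le_div_iff₀ (by positivity)]
    change a n * 2 ^ n ≤ _
    linarith [Real.add_one_le_exp (2 * (2 ^ n * a n))]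
end

section
/- (Lemma A.4 of the paper.) For all z, ẑ ∈ ℂ the following hold: (i) W_x(θ(z,·), φ(z,·)) = 1 for all x ∈ (a,b); (ii) the limit lim_{x→a⁺} W_x(θ(z,·), φ(ẑ,·)) exists and equals 1; (iii) the limits lim_{x→a⁺} W_x(φ(ẑ,·), φ(z,·)) and lim_{x→a⁺} W_x(θ(ẑ,·), θ(z,·)) exist and equal 0. -/
open MeasureTheory Filter Set Complex Topology

noncomputable section

/-- The Wronskian `W_x(u, v) = u(x) v'(x) - u'(x) v(x)`, derivatives supplied as data. -/
def Wr (u u' v v' : ℝ → ℂ) (x : ℝ) : ℂ := u x * v' x - u' x * v x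

/-- `u` (with derivative `u'`) is a solution of `-u'' + q u = z u` on the open set `S`. -/
def IsSol (S : Set ℝ) (q : ℝ → ℝ) (z : ℂ) (u u' : ℝ → ℂ) : Prop :=
  (∀ x ∈ S, HasDerivAt u (u' x) x) ∧
  ∀ x ∈ S, ∀ y ∈ S, u' y - u' x = ∫ t in x..y, ((q t : ℂ) - z) * u t

/-- The Wronskian of two solutions for the same spectral parameter has derivative zero, although
the derivatives of the solutions themselves need not be differentiable everywhere. -/
lemma IsSol.hasDerivAt_wr {S : Set ℝ} (hSo : IsOpen S) {q : ℝ → ℝ}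
    (hq : ∀ x ∈ S, ∀ y ∈ S, IntegrableOn q (uIcc x y)) {z : ℂ} {u u' v v' : ℝ → ℂ}
    (hu : IsSol S q z u u') (hv : IsSol S q z v v') {x : ℝ} (hx : x ∈ S) :
    HasDerivAt (Wr u u' v v') 0 x := by
  obtain ⟨ε, hε, hεS⟩ := Metric.nhds_basis_closedBall.mem_iff.1 (hSo.mem_nhds hx)
  rw [Real.closedBall_eq_Icc] at hεS
  have hle : x - ε ≤ x + ε := by linarith
  have hxI : x ∈ uIcc (x - ε) (x + ε) := by
    rw [uIcc_of_le hle]; constructor <;> linarith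
  have hN : uIcc (x - ε) (x + ε) ∈ 𝓝 x := by
    rw [uIcc_of_le hle]; exact Icc_mem_nhds (by linarith) (by linarith)
  have hIS : uIcc (x - ε) (x + ε) ⊆ S := by rwa [uIcc_of_le hle]
  have hqI : IntervalIntegrable (fun t => ((q t : ℂ) - z)) volume (x - ε) (x + ε) := by
    have h : IntervalIntegrable q volume (x - ε) (x + ε) :=
      (hq _ (hIS left_mem_uIcc) _ (hIS right_mem_uIcc)).intervalIntegrable
    exact IntervalIntegrable.sub ⟨h.1.ofReal, h.2.ofReal⟩ intervalIntegrable_const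
  have hprim : ∀ {E : Type} [NormedAddCommGroup E] [NormedSpace ℝ E] {f : ℝ → E},
      IntervalIntegrable f volume (x - ε) (x + ε) →
      Tendsto (fun y => ∫ t in x..y, f t) (𝓝 x) (𝓝 0) := by
    intro E _ _ f hf
    have h := ((intervalIntegral.continuousOn_primitive_interval' hf hxI).continuousAt hN).tendsto
    simpa using h
  have hcont : ∀ {w w' : ℝ → ℂ}, IsSol S q z w w' → ContinuousOn w (uIcc (x - ε) (x + ε)) :=
    fun hw t ht => (hw.1 t (hIS ht)).continuousAt.continuousWithinAt
  have hint : ∀ {w w' : ℝ → ℂ}, IsSol S q z w w' →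
      IntervalIntegrable (fun t => ((q t : ℂ) - z) * w t) volume (x - ε) (x + ε) :=
    fun hw => hqI.mul_continuousOn (hcont hw)
  have hsub : ∀ {y}, y ∈ uIcc (x - ε) (x + ε) → uIcc x y ⊆ uIcc (x - ε) (x + ε) :=
    fun hy => uIcc_subset_uIcc hxI hy
  have hder : ∀ {w w' : ℝ → ℂ}, IsSol S q z w w' →
      (fun y => w' y - w' x) =o[𝓝 x] (fun _ => (1 : ℝ)) := by
    intro w w' hw
    rw [Asymptotics.isLittleO_one_iff]
    refine (hprim (hint hw)).congr' ?_
    filter_upwards [hN] with y hy using (hw.2 x hx y (hIS hy)).symm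
  have hO : ∀ {w w' : ℝ → ℂ}, IsSol S q z w w' →
      (fun y => w y - w x) =O[𝓝 x] (fun y => y - x) :=
    fun hw => (hw.1 x hx).isBigO_sub
  have hcross : ∀ {w w' r r' : ℝ → ℂ}, IsSol S q z w w' → IsSol S q z r r' →
      (fun y => (w y - w x) * (r' y - r' x)) =o[𝓝 x] (fun y => y - x) := by
    intro w w' r r' hw hr
    simpa using (hO hw).mul_isLittleO (hder hr)
  have hlin : HasDerivAt (fun y => u y * v' x - v y * u' x) 0 x :=
    (((hu.1 x hx).mul_const (v' x)).sub ((hv.1 x hx).mul_const (u' x))).congr_deriv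
      (by ring)
  have hg : HasDerivAt (fun t => u x * v t - v x * u t) (u x * v' x - v x * u' x) x :=
    ((hv.1 x hx).const_mul (u x)).sub ((hu.1 x hx).const_mul (v x))
  have hrem : (fun y => ∫ t in x..y, ((q t : ℂ) - z) * (u x * v t - v x * u t))
      =o[𝓝 x] (fun y => y - x) := by
    obtain ⟨C, hC⟩ := hg.isBigO_sub.bound
    obtain ⟨δ, hδ, hδC⟩ := Metric.nhds_basis_ball.mem_iff.1 hC
    have hsmall : (fun y => ∫ t in x..y, ‖(q t : ℂ) - z‖) =o[𝓝 x] (fun _ => (1 : ℝ)) :=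
      (Asymptotics.isLittleO_one_iff ℝ).2 (hprim hqI.norm)
    have hprod : (fun y => (C * (y - x)) * ∫ t in x..y, ‖(q t : ℂ) - z‖)
        =o[𝓝 x] (fun y => y - x) := by
      simpa using ((Asymptotics.isBigO_refl (fun y => y - x) (𝓝 x)).const_mul_left C).mul_isLittleO
        hsmall
    refine Asymptotics.IsBigO.trans_isLittleO (.of_bound 1 ?_) hprod
    filter_upwards [hN, Metric.ball_mem_nhds x hδ] with y hy hyδ
    have hCt : ∀ t ∈ uIoc x y, ‖u x * v t - v x * u t‖ ≤ |C * (y - x)| := by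
      intro t ht
      have habs : |t - x| ≤ |y - x| := abs_sub_left_of_mem_uIcc (uIoc_subset_uIcc ht)
      have ht' : t ∈ Metric.ball x δ := by
        rw [Metric.mem_ball, Real.dist_eq] at hyδ ⊢; exact habs.trans_lt hyδ
      have h := hδC ht'
      simp only [mem_ofPred_eq, Real.norm_eq_abs] at h
      have h0 : u x * v t - v x * u t - (u x * v x - v x * u x) = u x * v t - v x * u t := by ring
      rw [h0] at h
      rw [abs_mul]
      exact h.trans (mul_le_mul (le_abs_self C) habs (abs_nonneg _) (abs_nonneg _))
    have hqy : IntervalIntegrable (fun t => ‖(q t : ℂ) - z‖) volume x y :=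
      hqI.norm.mono_set (hsub hy)
    have h := intervalIntegral.norm_integral_le_abs_of_norm_le (μ := volume) (a := x) (b := y)
      (f := fun t => ((q t : ℂ) - z) * (u x * v t - v x * u t))
      (g := fun t => |C * (y - x)| * ‖(q t : ℂ) - z‖)
      ((ae_restrict_iff' measurableSet_uIoc).2 (.of_forall fun t ht => by
        rw [norm_mul, mul_comm]
        exact mul_le_mul_of_nonneg_right (hCt t ht) (norm_nonneg _)))
      (hqy.const_mul _)
    rw [intervalIntegral.integral_const_mul, abs_mul, abs_abs, ← abs_mul] at h
    simpa using h
  rw [hasDerivAt_iff_isLittleO] at hlin ⊢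
  refine (((hlin.add hrem).add (hcross hu hv)).sub (hcross hv hu)).congr' ?_ .rfl
  filter_upwards [hN] with y hy
  have hIu : IntervalIntegrable (fun t => ((q t : ℂ) - z) * u t) volume x y :=
    (hint hu).mono_set (hsub hy)
  have hIv : IntervalIntegrable (fun t => ((q t : ℂ) - z) * v t) volume x y :=
    (hint hv).mono_set (hsub hy)
  have hsplit : ∫ t in x..y, ((q t : ℂ) - z) * (u x * v t - v x * u t) =
      u x * (v' y - v' x) - v x * (u' y - u' x) := by
    rw [hu.2 x hx y (hIS hy), hv.2 x hx y (hIS hy), ← intervalIntegral.integral_const_mul,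
      ← intervalIntegral.integral_const_mul,
      ← intervalIntegral.integral_sub (hIv.const_mul _) (hIu.const_mul _)]
    congr 1; ext t; ring
  rw [hsplit]
  simp only [Wr, smul_zero]
  ring

/-- The Wronskian of two solutions for the same spectral parameter is constant. -/
lemma IsSol.wr_eq {S : Set ℝ} (hSo : IsOpen S) (hSc : IsPreconnected S) {q : ℝ → ℝ}
    (hq : ∀ x ∈ S, ∀ y ∈ S, IntegrableOn q (uIcc x y)) {z : ℂ} {u u' v v' : ℝ → ℂ}
    (hu : IsSol S q z u u') (hv : IsSol S q z v v') {x y : ℝ} (hx : x ∈ S) (hy : y ∈ S) :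
    Wr u u' v v' x = Wr u u' v v' y :=
  hSo.is_const_of_deriv_eq_zero hSc
    (fun _ ht => (hu.hasDerivAt_wr hSo hq hv ht).differentiableAt.differentiableWithinAt)
    (fun _ ht => (hu.hasDerivAt_wr hSo hq hv ht).deriv) hx hy

/-- The Plücker identity for Wronskians. -/
lemma wr_mul_wr (u u' v v' f f' g g' : ℝ → ℂ) (x : ℝ) :
    Wr u u' v v' x * Wr f f' g g' x =
      Wr u u' f f' x * Wr v v' g g' x - Wr u u' g g' x * Wr v v' f f' x := by
  simp only [Wr]; ring

lemma EReal.Ioo_mem_comap_coe_nhdsGT {a b : EReal} (hab : a < b) :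
    {x : ℝ | a < (x : EReal) ∧ (x : EReal) < b} ∈
      Filter.comap (fun x : ℝ => (x : EReal)) (𝓝[>] a) :=
  preimage_mem_comap (Ioo_mem_nhdsGT hab)

lemma EReal.comap_coe_nhdsGT_neBot {a b : EReal} (hab : a < b) :
    (Filter.comap (fun x : ℝ => (x : EReal)) (𝓝[>] a)).NeBot := by
  rw [comap_neBot_iff]
  intro t ht
  have : (𝓝[>] a).NeBot := nhdsGT_neBot_of_exists_gt ⟨b, hab⟩
  obtain ⟨e, het, hae, heb⟩ := Filter.nonempty_of_mem (inter_mem ht (Ioo_mem_nhdsGT hab))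
  lift e to ℝ using ⟨(heb.trans_le le_top).ne, (bot_le.trans_lt hae).ne'⟩
  exact ⟨e, het⟩

/-- Lemma A.4: Let `φ₀, θ₀` be real-valued solutions of `-u'' + qu = λ₀ u`
with `W(θ₀,φ₀) = 1` and suppose for every `z` and every solution `u` of `-u'' + qu = zu`
the limits `W_a(φ₀,u)` and `W_a(θ₀,u)` (as `x → a⁺`, encoded by the filter `Fa`) exist.
With `φ(z,x) = W_a(c(z),φ₀) s(z,x) - W_a(s(z),φ₀) c(z,x)` and
`θ(z,x) = W_a(c(z),θ₀) s(z,x) - W_a(s(z),θ₀) c(z,x)`, one has, for all `z, ẑ ∈ ℂ`: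
(i) `W_x(θ(z),φ(z)) = 1` on `(a,b)`; (ii) `W_x(θ(z),φ(ẑ)) → 1` as `x → a⁺`;
(iii) `W_x(φ(ẑ),φ(z)) → 0` and `W_x(θ(ẑ),θ(z)) → 0` as `x → a⁺`. -/
theorem stmt_12
    (a b : EReal) (hab : a < b)
    (S : Set ℝ) (hS : S = {x : ℝ | a < (x : EReal) ∧ (x : EReal) < b})
    (q : ℝ → ℝ) (hq : ∀ x ∈ S, ∀ y ∈ S, IntegrableOn q (uIcc x y))
    (c : ℝ) (hc : c ∈ S) (lam : ℝ)
    (Fa : Filter ℝ) (hFa : Fa = Filter.comap (fun x : ℝ => (x : EReal)) (𝓝[>] a))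
    (φ₀ φ₀' θ₀ θ₀' : ℝ → ℂ)
    (hφ₀r : ∀ x, (φ₀ x).im = 0) (hφ₀'r : ∀ x, (φ₀' x).im = 0)
    (hθ₀r : ∀ x, (θ₀ x).im = 0) (hθ₀'r : ∀ x, (θ₀' x).im = 0)
    (hφ₀ : IsSol S q (lam : ℂ) φ₀ φ₀') (hθ₀ : IsSol S q (lam : ℂ) θ₀ θ₀')
    (hW0 : ∀ x ∈ S, Wr θ₀ θ₀' φ₀ φ₀' x = 1)
    (cc cc' ss ss' : ℂ → ℝ → ℂ)
    (hcc : ∀ z : ℂ, IsSol S q z (cc z) (cc' z))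
    (hss : ∀ z : ℂ, IsSol S q z (ss z) (ss' z))
    (hcinit : ∀ z : ℂ, cc z c = 1 ∧ cc' z c = 0)
    (hsinit : ∀ z : ℂ, ss z c = 0 ∧ ss' z c = 1)
    (hlim : ∀ z : ℂ, ∀ u u' : ℝ → ℂ, IsSol S q z u u' →
      (∃ L : ℂ, Tendsto (Wr φ₀ φ₀' u u') Fa (𝓝 L)) ∧
      (∃ L : ℂ, Tendsto (Wr θ₀ θ₀' u u') Fa (𝓝 L)))
    (Wcφ Wsφ Wcθ Wsθ : ℂ → ℂ)
    (hWcφ : ∀ z : ℂ, Tendsto (Wr (cc z) (cc' z) φ₀ φ₀') Fa (𝓝 (Wcφ z)))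
    (hWsφ : ∀ z : ℂ, Tendsto (Wr (ss z) (ss' z) φ₀ φ₀') Fa (𝓝 (Wsφ z)))
    (hWcθ : ∀ z : ℂ, Tendsto (Wr (cc z) (cc' z) θ₀ θ₀') Fa (𝓝 (Wcθ z)))
    (hWsθ : ∀ z : ℂ, Tendsto (Wr (ss z) (ss' z) θ₀ θ₀') Fa (𝓝 (Wsθ z)))
    (φ φ' θ θ' : ℂ → ℝ → ℂ)
    (hφdef : ∀ z x, φ z x = Wcφ z * ss z x - Wsφ z * cc z x)
    (hφ'def : ∀ z x, φ' z x = Wcφ z * ss' z x - Wsφ z * cc' z x)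
    (hθdef : ∀ z x, θ z x = Wcθ z * ss z x - Wsθ z * cc z x)
    (hθ'def : ∀ z x, θ' z x = Wcθ z * ss' z x - Wsθ z * cc' z x) :
    (∀ z : ℂ, ∀ x ∈ S, Wr (θ z) (θ' z) (φ z) (φ' z) x = 1) ∧
    (∀ z w : ℂ, Tendsto (Wr (θ z) (θ' z) (φ w) (φ' w)) Fa (𝓝 1)) ∧
    (∀ z w : ℂ, Tendsto (Wr (φ w) (φ' w) (φ z) (φ' z)) Fa (𝓝 0)) ∧
    (∀ z w : ℂ, Tendsto (Wr (θ w) (θ' w) (θ z) (θ' z)) Fa (𝓝 0)) := by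
  have hSFa : S ∈ Fa := by
    rw [hS, hFa]; exact EReal.Ioo_mem_comap_coe_nhdsGT hab
  have : Fa.NeBot := by
    rw [hFa]; exact EReal.comap_coe_nhdsGT_neBot hab
  have hSo : IsOpen S := by
    rw [hS]; exact isOpen_Ioo.preimage continuous_coe_real_ereal
  have hSc : IsPreconnected S := by
    refine OrdConnected.isPreconnected ⟨fun x hx y hy t ht => ?_⟩
    rw [hS] at hx hy ⊢
    exact ⟨hx.1.trans_le (EReal.coe_le_coe_iff.2 ht.1),
      (EReal.coe_le_coe_iff.2 ht.2).trans_lt hy.2⟩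
  have hcs : ∀ z, ∀ x ∈ S, Wr (cc z) (cc' z) (ss z) (ss' z) x = 1 := by
    intro z x hx
    rw [(hcc z).wr_eq hSo hSc hq (hss z) hx hc]
    simp [Wr, hcinit z, hsinit z]
  have hdet : ∀ z, Wcθ z * Wsφ z - Wcφ z * Wsθ z = 1 := by
    intro z
    refine tendsto_nhds_unique
      (((hWcθ z).mul (hWsφ z)).sub ((hWcφ z).mul (hWsθ z))) (tendsto_const_nhds.congr' ?_)
    filter_upwards [hSFa] with x hx
    rw [← wr_mul_wr, hcs z x hx, hW0 x hx, one_mul]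
  -- limits of the Wronskians of `φ` and `θ` with the reference solutions
  have hφφ₀ : ∀ z, Tendsto (Wr (φ z) (φ' z) φ₀ φ₀') Fa (𝓝 0) := by
    intro z
    have h := ((hWsφ z).const_mul (Wcφ z)).sub ((hWcφ z).const_mul (Wsφ z))
    refine (h.congr fun x => ?_).trans (by rw [mul_comm, sub_self])
    simp only [Wr, hφdef, hφ'def]; ring
  have hφθ₀ : ∀ z, Tendsto (Wr (φ z) (φ' z) θ₀ θ₀') Fa (𝓝 (-1)) := by
    intro z
    have h := ((hWsθ z).const_mul (Wcφ z)).sub ((hWcθ z).const_mul (Wsφ z))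
    rw [show Wcφ z * Wsθ z - Wsφ z * Wcθ z = -1 by linear_combination -hdet z] at h
    refine h.congr fun x => ?_
    simp only [Wr, hφdef, hφ'def]; ring
  have hθφ₀ : ∀ z, Tendsto (Wr (θ z) (θ' z) φ₀ φ₀') Fa (𝓝 1) := by
    intro z
    have h := ((hWsφ z).const_mul (Wcθ z)).sub ((hWcφ z).const_mul (Wsθ z))
    rw [show Wcθ z * Wsφ z - Wsθ z * Wcφ z = 1 by linear_combination hdet z] at h
    refine h.congr fun x => ?_
    simp only [Wr, hθdef, hθ'def]; ring
  have hθθ₀ : ∀ z, Tendsto (Wr (θ z) (θ' z) θ₀ θ₀') Fa (𝓝 0) := by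
    intro z
    have h := ((hWsθ z).const_mul (Wcθ z)).sub ((hWcθ z).const_mul (Wsθ z))
    rw [show Wcθ z * Wsθ z - Wsθ z * Wcθ z = 0 by ring] at h
    refine h.congr fun x => ?_
    simp only [Wr, hθdef, hθ'def]; ring
  have hlimWr : ∀ {u u' v v' : ℝ → ℂ} {A B C D : ℂ},
      Tendsto (Wr u u' θ₀ θ₀') Fa (𝓝 A) → Tendsto (Wr v v' φ₀ φ₀') Fa (𝓝 B) →
      Tendsto (Wr u u' φ₀ φ₀') Fa (𝓝 C) → Tendsto (Wr v v' θ₀ θ₀') Fa (𝓝 D) →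
      Tendsto (Wr u u' v v') Fa (𝓝 (A * B - C * D)) := by
    intro u u' v v' A B C D hA hB hC hD
    refine ((hA.mul hB).sub (hC.mul hD)).congr' ?_
    filter_upwards [hSFa] with x hx
    rw [← wr_mul_wr, hW0 x hx, mul_one]
  refine ⟨fun z x hx => ?_, fun z w => ?_, fun z w => ?_, fun z w => ?_⟩
  · have h := hcs z x hx
    simp only [Wr] at h
    simp only [Wr, hφdef, hφ'def, hθdef, hθ'def]
    linear_combination (Wcθ z * Wsφ z - Wcφ z * Wsθ z) * h + hdet z
  · simpa using hlimWr (hθθ₀ z) (hφφ₀ w) (hθφ₀ z) (hφθ₀ w)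
  · simpa using hlimWr (hφθ₀ w) (hφφ₀ z) (hφφ₀ w) (hφθ₀ z)
  · simpa using hlimWr (hθθ₀ w) (hθφ₀ z) (hθφ₀ w) (hθθ₀ z)
end
end
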